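/- There is no function f from the set of all unit vectors of ℝ³ to {0, 1} such that for every orthonormal basis (u, v, w) of ℝ³, exactly one of f(u), f(v), f(w) equals 1. That is, the full set of rank-1 projections (equivalently, of rays) in dimension 3 is a Kochen–Specker set. -/

import Mathlib

open scoped RealInnerProductSpace

/-- A colouring of the nonzero integer vectors in dimension 3 (those satisfying `P` having the
value 1) such that exactly one vector of every orthogonal triple has the value 1. -/
def IsIntegerKSColouring (P : (Fin 3 → ℤ) → Prop) : Prop :=
  ∀ u v w : Fin 3 → ℤ, u ≠ 0 → v ≠ 0 → w ≠ 0 → u ⬝ᵥ v = 0 → u ⬝ᵥ w = 0 → v ⬝ᵥ w = 0 →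
    (P u ∧ ¬ P v ∧ ¬ P w) ∨ (¬ P u ∧ P v ∧ ¬ P w) ∨ (¬ P u ∧ ¬ P v ∧ P w)

namespace IsIntegerKSColouring

variable {P : (Fin 3 → ℤ) → Prop}

/-- Colourings pull back along signed coordinate permutations. -/
theorem comp_signedPerm (hP : IsIntegerKSColouring P) (σ : Equiv.Perm (Fin 3)) (s : Fin 3 → ℤˣ) :
    IsIntegerKSColouring fun u ↦ P fun i ↦ (s i : ℤ) * u (σ i) := by
  have dot_eq (u v : Fin 3 → ℤ) :
      (fun i ↦ (s i : ℤ) * u (σ i)) ⬝ᵥ (fun i ↦ (s i : ℤ) * v (σ i)) = u ⬝ᵥ v := by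
    rw [dotProduct, dotProduct, ← Equiv.sum_comp σ fun i ↦ u i * v i]
    refine Finset.sum_congr rfl fun i _ ↦ ?_
    rw [mul_mul_mul_comm, ← Units.val_mul, Int.units_mul_self, Units.val_one, one_mul]
  have ne_zero {u : Fin 3 → ℤ} (hu : u ≠ 0) : (fun i ↦ (s i : ℤ) * u (σ i)) ≠ 0 := by
    rwa [Ne, ← dotProduct_self_eq_zero, dot_eq, dotProduct_self_eq_zero]
  intro u v w hu hv hw huv huw hvw
  exact hP _ _ _ (ne_zero hu) (ne_zero hv) (ne_zero hw) (by rwa [dot_eq]) (by rwa [dot_eq])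
    (by rwa [dot_eq])

theorem false_of_axis_of_diagonals (hP : IsIntegerKSColouring P) (h₁ : P ![0, 0, 1]) (h₂ : P ![1, 0, 1])
    (h₃ : P ![0, 1, 1]) : False := by
  have t₁ := hP ![1, 0, 1] ![-2, 1, 2] ![-1, -4, 1]
    (by decide) (by decide) (by decide) (by decide) (by decide) (by decide)
  have t₂ := hP ![0, 1, 1] ![1, -2, 2] ![4, 1, -1]
    (by decide) (by decide) (by decide) (by decide) (by decide) (by decide)
  have t₃ := hP ![2, 2, 1] ![-2, 1, 2] ![1, -2, 2]
    (by decide) (by decide) (by decide) (by decide) (by decide) (by decide)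
  have t₄ := hP ![2, 2, 1] ![0, -1, 2] ![5, -4, -2]
    (by decide) (by decide) (by decide) (by decide) (by decide) (by decide)
  have t₅ := hP ![0, 0, 1] ![1, 0, 0] ![0, 1, 0]
    (by decide) (by decide) (by decide) (by decide) (by decide) (by decide)
  have t₆ := hP ![0, 0, 1] ![1, 1, 0] ![1, -1, 0]
    (by decide) (by decide) (by decide) (by decide) (by decide) (by decide)
  have t₇ := hP ![1, 0, 1] ![-1, 1, 1] ![-1, -2, 1]
    (by decide) (by decide) (by decide) (by decide) (by decide) (by decide)
  have t₈ := hP ![1, -1, 2] ![1, 1, 0] ![-1, 1, 1]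
    (by decide) (by decide) (by decide) (by decide) (by decide) (by decide)
  have t₉ := hP ![1, -1, 2] ![0, 2, 1] ![-5, -1, 2]
    (by decide) (by decide) (by decide) (by decide) (by decide) (by decide)
  have t₁₀ := hP ![1, 0, 0] ![0, -1, 2] ![0, 2, 1]
    (by decide) (by decide) (by decide) (by decide) (by decide) (by decide)
  grind

theorem false_of_axis (hP : IsIntegerKSColouring P) (h : P ![0, 0, 1]) : False := by
  have t₁ := hP ![0, 0, 1] ![1, 0, 0] ![0, 1, 0]
    (by decide) (by decide) (by decide) (by decide) (by decide) (by decide)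
  have t₂ := hP ![0, 1, 0] ![1, 0, 1] ![-1, 0, 1]
    (by decide) (by decide) (by decide) (by decide) (by decide) (by decide)
  have t₃ := hP ![1, 0, 0] ![0, 1, 1] ![0, -1, 1]
    (by decide) (by decide) (by decide) (by decide) (by decide) (by decide)
  have reflect (s : Fin 3 → ℤˣ) (u v : Fin 3 → ℤ) (huv : (fun i ↦ (s i : ℤ) * u i) = v)
      (hv : P v) : P fun i ↦ (s i : ℤ) * u i := huv ▸ hv
  have hx : P ![1, 0, 1] ∨ P ![-1, 0, 1] := by tauto
  have hy : P ![0, 1, 1] ∨ P ![0, -1, 1] := by tauto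
  rcases hx with hx | hx <;> rcases hy with hy | hy
  · exact hP.false_of_axis_of_diagonals h hx hy
  · exact (hP.comp_signedPerm 1 ![1, -1, 1]).false_of_axis_of_diagonals (reflect _ _ _ (by decide) h)
      (reflect _ _ _ (by decide) hx) (reflect _ _ _ (by decide) hy)
  · exact (hP.comp_signedPerm 1 ![-1, 1, 1]).false_of_axis_of_diagonals (reflect _ _ _ (by decide) h)
      (reflect _ _ _ (by decide) hx) (reflect _ _ _ (by decide) hy)
  · exact (hP.comp_signedPerm 1 ![-1, -1, 1]).false_of_axis_of_diagonals (reflect _ _ _ (by decide) h)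
      (reflect _ _ _ (by decide) hx) (reflect _ _ _ (by decide) hy)

end IsIntegerKSColouring

/-- Already the integer vectors in dimension 3 admit no Kochen–Specker colouring. -/
theorem not_isIntegerKSColouring (P : (Fin 3 → ℤ) → Prop) : ¬ IsIntegerKSColouring P := by
  intro hP
  have permute (σ : Equiv.Perm (Fin 3)) (v : Fin 3 → ℤ)
      (hσ : (fun i ↦ (((1 : Fin 3 → ℤˣ) i : ℤˣ) : ℤ) * (![0, 0, 1] : Fin 3 → ℤ) (σ i)) = v)
      (hv : P v) : False :=
    (hP.comp_signedPerm σ 1).false_of_axis (hσ ▸ hv)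
  rcases hP ![1, 0, 0] ![0, 1, 0] ![0, 0, 1]
    (by decide) (by decide) (by decide) (by decide) (by decide) (by decide) with h | h | h
  · exact permute (Equiv.swap 0 2) _ (by decide) h.1
  · exact permute (Equiv.swap 1 2) _ (by decide) h.2.1
  · exact hP.false_of_axis h.2.2

/-- An integer vector, viewed in Euclidean space. -/
noncomputable def intVec (u : Fin 3 → ℤ) : EuclideanSpace ℝ (Fin 3) :=
  WithLp.toLp 2 fun i ↦ (u i : ℝ)

theorem inner_intVec (u v : Fin 3 → ℤ) : ⟪intVec u, intVec v⟫ = ((u ⬝ᵥ v : ℤ) : ℝ) := by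
  simp [intVec, PiLp.inner_apply, dotProduct, mul_comm]

theorem intVec_ne_zero {u : Fin 3 → ℤ} (hu : u ≠ 0) : intVec u ≠ 0 := by
  rwa [← inner_self_ne_zero (𝕜 := ℝ), inner_intVec, Int.cast_ne_zero, Ne,
    dotProduct_self_eq_zero]

/-- Bell; via Gleason's theorem. There is no function `f` from the unit
vectors of ℝ³ to `{0, 1}` such that for every orthonormal basis `(u, v, w)` of ℝ³ exactly
one of `f u`, `f v`, `f w` equals 1: the full set of rays in dimension 3 is a
Kochen–Specker set. -/
theorem no_KS_colouring_of_sphere :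
    ¬ ∃ f : EuclideanSpace ℝ (Fin 3) → Fin 2,
      ∀ u v w : EuclideanSpace ℝ (Fin 3),
        ‖u‖ = 1 → ‖v‖ = 1 → ‖w‖ = 1 →
        ⟪u, v⟫ = 0 → ⟪u, w⟫ = 0 → ⟪v, w⟫ = 0 →
        ((f u = 1 ∧ f v = 0 ∧ f w = 0) ∨
         (f u = 0 ∧ f v = 1 ∧ f w = 0) ∨
         (f u = 0 ∧ f v = 0 ∧ f w = 1)) := by
  rintro ⟨f, hf⟩
  refine not_isIntegerKSColouring (fun u ↦ f (‖intVec u‖⁻¹ • intVec u) = 1) ?_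
  have norm_eq {u : Fin 3 → ℤ} (hu : u ≠ 0) : ‖‖intVec u‖⁻¹ • intVec u‖ = 1 :=
    norm_smul_inv_norm (𝕜 := ℝ) (intVec_ne_zero hu)
  have inner_eq {u v : Fin 3 → ℤ} (huv : u ⬝ᵥ v = 0) :
      ⟪‖intVec u‖⁻¹ • intVec u, ‖intVec v‖⁻¹ • intVec v⟫ = 0 := by
    simp [real_inner_smul_left, real_inner_smul_right, inner_intVec, huv]
  intro u v w hu hv hw huv huw hvw
  rcases hf _ _ _ (norm_eq hu) (norm_eq hv) (norm_eq hw) (inner_eq huv) (inner_eq huw)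
    (inner_eq hvw) with h | h | h <;> simp [h]
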